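/- (Proposition: local constancy of orbital integrals along the section, converse part) For every locally constant compactly supported function φ : F^n × F^{n+1} → ℂ, there exists a smooth compactly supported function f : M_{n+1}(F) → ℂ with support contained in M_{n+1,+} such that for every (a,b) ∈ F^n × F^{n+1} the function h ↦ f(h·σ(a,b))·η(det h) is absolutely μ-integrable and ∫_{GL_n(F)} f(h·σ(a,b))·η(det h) dμ(h) = φ(a,b). -/

import Mathlib

open Matrix MeasureTheory

namespace ZhangRTF

variable {F : Type*} [Field F] {n : ℕ}

/-- Block diagonal embedding `diag(h,1) ∈ M_{n+1}(F)` of `h ∈ M_n(F)`. -/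
def emb (h : Matrix (Fin n) (Fin n) F) : Matrix (Fin (n + 1)) (Fin (n + 1)) F :=
  Matrix.of fun i j =>
    if hi : (i : ℕ) < n then
      (if hj : (j : ℕ) < n then h ⟨i, hi⟩ ⟨j, hj⟩ else 0)
    else (if (j : ℕ) < n then 0 else 1)

/-- Conjugation action of `GL_n(F)` on `M_{n+1}(F)`: `h·X = diag(h,1) X diag(h,1)⁻¹`. -/
def act (h : Matrix.GeneralLinearGroup (Fin n) F)
    (X : Matrix (Fin (n + 1)) (Fin (n + 1)) F) : Matrix (Fin (n + 1)) (Fin (n + 1)) F :=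
  emb (h : Matrix (Fin n) (Fin n) F) * X *
    emb ((h⁻¹ : Matrix.GeneralLinearGroup (Fin n) F) : Matrix (Fin n) (Fin n) F)

/-- The upper-left `n × n` block `A` of `X = [[A,u],[v,w]]`. -/
def blockA (X : Matrix (Fin (n + 1)) (Fin (n + 1)) F) : Matrix (Fin n) (Fin n) F :=
  Matrix.of fun i j => X i.castSucc j.castSucc

/-- The upper-right column `u` of `X = [[A,u],[v,w]]`. -/
def blockU (X : Matrix (Fin (n + 1)) (Fin (n + 1)) F) : Fin n → F :=
  fun i => X i.castSucc (Fin.last n)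

/-- The lower-left row `v` of `X = [[A,u],[v,w]]`. -/
def blockV (X : Matrix (Fin (n + 1)) (Fin (n + 1)) F) : Fin n → F :=
  fun j => X (Fin.last n) j.castSucc

/-- The lower-right corner `w` of `X = [[A,u],[v,w]]`. -/
def blockW (X : Matrix (Fin (n + 1)) (Fin (n + 1)) F) : F :=
  X (Fin.last n) (Fin.last n)

/-- `δ₊(X)`: the matrix whose `j`-th column is `A^{n-j} u` (`1 ≤ j ≤ n`, 1-indexed). -/
def deltaPlus (X : Matrix (Fin (n + 1)) (Fin (n + 1)) F) : Matrix (Fin n) (Fin n) F :=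
  Matrix.of fun i j => (blockA X ^ (n - 1 - (j : ℕ)) *ᵥ blockU X) i

/-- `δ₋(X)`: the matrix whose `i`-th row is `v A^{i-1}` (`1 ≤ i ≤ n`, 1-indexed). -/
def deltaMinus (X : Matrix (Fin (n + 1)) (Fin (n + 1)) F) : Matrix (Fin n) (Fin n) F :=
  Matrix.of fun i j => (blockV X ᵥ* blockA X ^ (i : ℕ)) j

/-- `Δ₊(X) = det δ₊(X)`. -/
def DeltaPlus (X : Matrix (Fin (n + 1)) (Fin (n + 1)) F) : F := (deltaPlus X).det

/-- `Δ₋(X) = det δ₋(X)`. -/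
def DeltaMinus (X : Matrix (Fin (n + 1)) (Fin (n + 1)) F) : F := (deltaMinus X).det

/-- The `a`-invariants: `a_i = -(coefficient of T^{n-i} in charpoly A)` (1-indexed). -/
noncomputable def aInv (X : Matrix (Fin (n + 1)) (Fin (n + 1)) F) : Fin n → F :=
  fun i => -((blockA X).charpoly.coeff (n - 1 - (i : ℕ)))

/-- The `b`-invariants: `b_0 = w` and `b_j = v A^{j-1} u` for `1 ≤ j ≤ n`. -/
def bInv (X : Matrix (Fin (n + 1)) (Fin (n + 1)) F) : Fin (n + 1) → F :=
  fun j => if (j : ℕ) = 0 then blockW X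
    else blockV X ⬝ᵥ (blockA X ^ ((j : ℕ) - 1) *ᵥ blockU X)

/-- The invariants map `π : M_{n+1}(F) → F^n × F^{n+1}`. -/
noncomputable def invMap (X : Matrix (Fin (n + 1)) (Fin (n + 1)) F) : (Fin n → F) × (Fin (n + 1) → F) :=
  (aInv X, bInv X)

/-- The regular nilpotent `ξ₊`: `(i,i+1)`-entries equal to `1`, all others `0`. -/
def xiPlus (n : ℕ) : Matrix (Fin (n + 1)) (Fin (n + 1)) F :=
  Matrix.of fun i j => if (j : ℕ) = (i : ℕ) + 1 then 1 else 0

/-- The section `σ(a,b)` of the invariants map. -/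
def sectSigma (a : Fin n → F) (b : Fin (n + 1) → F) : Matrix (Fin (n + 1)) (Fin (n + 1)) F :=
  Matrix.of fun i j =>
    if hi : (i : ℕ) < n then
      (if (j : ℕ) = 0 then a ⟨i, hi⟩ else 0) + (if (j : ℕ) = (i : ℕ) + 1 then 1 else 0)
    else b j.rev

/-- The variant section `σ'(a,b)`. -/
def sectSigma' (a : Fin n → F) (b : Fin (n + 1) → F) : Matrix (Fin (n + 1)) (Fin (n + 1)) F :=
  Matrix.of fun i j =>
    if (i : ℕ) < n - 1 then (if (j : ℕ) = (i : ℕ) + 1 then 1 else 0)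
    else if (i : ℕ) = n - 1 then
      (if hj : (j : ℕ) < n then a ⟨n - 1 - (j : ℕ), by omega⟩ else 1)
    else b j.rev

/-- Membership in `N_{n,-}`: lower triangular with unit diagonal. -/
def IsLowerUni (h : Matrix (Fin n) (Fin n) F) : Prop :=
  (∀ i, h i i = 1) ∧ ∀ i j : Fin n, i < j → h i j = 0

/-- Membership in `N_n`: upper triangular with unit diagonal. -/
def IsUpperUni (h : Matrix (Fin n) (Fin n) F) : Prop :=
  (∀ i, h i i = 1) ∧ ∀ i j : Fin n, j < i → h i j = 0

/-- Membership in the subvariety `𝒲`: superdiagonal entries `1`,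
entries above the superdiagonal `0`. -/
def memW (X : Matrix (Fin (n + 1)) (Fin (n + 1)) F) : Prop :=
  ∀ i j : Fin (n + 1),
    ((j : ℕ) = (i : ℕ) + 1 → X i j = 1) ∧ ((i : ℕ) + 1 < (j : ℕ) → X i j = 0)

/-- `p : 𝒲 → 𝒱`, replacing the last row by zero. -/
def pMap (X : Matrix (Fin (n + 1)) (Fin (n + 1)) F) : Matrix (Fin (n + 1)) (Fin (n + 1)) F :=
  Matrix.of fun i j => if (i : ℕ) = n then 0 else X i j

/-- `p' : 𝒲 → 𝒱'`, replacing the last row and the first column by zero. -/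
def pMap' (X : Matrix (Fin (n + 1)) (Fin (n + 1)) F) : Matrix (Fin (n + 1)) (Fin (n + 1)) F :=
  Matrix.of fun i j => if (i : ℕ) = n ∨ (j : ℕ) = 0 then 0 else X i j

/-- The determinant of an element of `GL_n(F)`, as a unit of `F`. -/
def GLdet (h : Matrix.GeneralLinearGroup (Fin n) F) : Fˣ :=
  Units.map Matrix.detMonoidHom h

end ZhangRTF

open ZhangRTF

namespace ZhangRTF

section Alg
variable {F : Type*} [Field F] {n : ℕ}

theorem emb_cc (h : Matrix (Fin n) (Fin n) F) (i j : Fin n) :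
    emb h i.castSucc j.castSucc = h i j := by simp [emb]
theorem emb_cl (h : Matrix (Fin n) (Fin n) F) (i : Fin n) :
    emb h i.castSucc (Fin.last n) = 0 := by simp [emb]
theorem emb_lc (h : Matrix (Fin n) (Fin n) F) (j : Fin n) :
    emb h (Fin.last n) j.castSucc = 0 := by simp [emb]
theorem emb_ll (h : Matrix (Fin n) (Fin n) F) :
    emb h (Fin.last n) (Fin.last n) = 1 := by simp [emb]

theorem emb_mul (g h : Matrix (Fin n) (Fin n) F) : emb (g * h) = emb g * emb h := by
  ext i j
  refine Fin.lastCases ?_ (fun i => ?_) i <;> refine Fin.lastCases ?_ (fun j => ?_) j <;>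
  simp [Matrix.mul_apply, Fin.sum_univ_castSucc, emb_cc, emb_cl, emb_lc, emb_ll]

theorem emb_one : emb (1 : Matrix (Fin n) (Fin n) F) = 1 := by
  ext i j
  refine Fin.lastCases ?_ (fun i => ?_) i <;> refine Fin.lastCases ?_ (fun j => ?_) j <;>
  simp [emb_cc, emb_cl, emb_lc, emb_ll, Matrix.one_apply, Fin.castSucc_ne_last, (Fin.castSucc_ne_last _).symm]

theorem blockA_conj (g k : Matrix (Fin n) (Fin n) F) (X : Matrix (Fin (n+1)) (Fin (n+1)) F) :
    blockA (emb g * X * emb k) = g * blockA X * k := by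
  ext i j
  simp [blockA, Matrix.mul_apply, Fin.sum_univ_castSucc, emb_cc, emb_cl, emb_lc, emb_ll]

theorem blockU_conj (g k : Matrix (Fin n) (Fin n) F) (X : Matrix (Fin (n+1)) (Fin (n+1)) F) :
    blockU (emb g * X * emb k) = g *ᵥ blockU X := by
  ext i
  simp [blockU, Matrix.mulVec, dotProduct, Matrix.mul_apply, Fin.sum_univ_castSucc, emb_cc, emb_cl, emb_lc, emb_ll]

theorem deltaPlus_conj (g k : Matrix (Fin n) (Fin n) F) (hk : k * g = 1)
    (X : Matrix (Fin (n+1)) (Fin (n+1)) F) :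
    deltaPlus (emb g * X * emb k) = g * deltaPlus X := by
  have hpow : ∀ m : ℕ, (g * blockA X * k) ^ m * g = g * blockA X ^ m := by
    intro m
    induction m with
    | zero => simp
    | succ m ih =>
      rw [pow_succ, Matrix.mul_assoc, Matrix.mul_assoc (g * blockA X), hk, Matrix.mul_one,
        ← Matrix.mul_assoc, ih, Matrix.mul_assoc, ← pow_succ]
  ext i j
  simp only [deltaPlus, Matrix.of_apply, blockA_conj, blockU_conj]
  rw [Matrix.mulVec_mulVec, hpow, ← Matrix.mulVec_mulVec]
  rfl

theorem deltaPlus_sigma (a : Fin n → F) (b : Fin (n + 1) → F) :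
    deltaPlus (sectSigma a b) = 1 := by
  have key : ∀ m : ℕ, ∀ hm : m < n,
      blockA (sectSigma a b) ^ m *ᵥ blockU (sectSigma a b) =
        Pi.single (⟨n - 1 - m, by omega⟩ : Fin n) 1 := by
    intro m
    induction m with
    | zero =>
      intro hm
      ext i
      have := i.isLt
      simp only [pow_zero, Matrix.one_mulVec, blockU, sectSigma, Matrix.of_apply, Pi.single_apply,
        Fin.ext_iff, Fin.val_castSucc, Fin.val_last]
      rw [dif_pos this, if_neg (by omega), zero_add]
      congr 1
      apply propext; omega
    | succ m ih =>
      intro hm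
      rw [pow_succ', ← Matrix.mulVec_mulVec, ih (by omega), Matrix.mulVec_single_one]
      ext i
      have := i.isLt
      simp only [Matrix.col_apply, blockA, sectSigma, Matrix.of_apply, Pi.single_apply,
        Fin.ext_iff, Fin.val_castSucc]
      rw [dif_pos this, if_neg (by omega), zero_add]
      congr 1
      apply propext; omega
  ext i j
  have := j.isLt
  simp only [deltaPlus, Matrix.of_apply]
  rw [key _ (by omega)]
  simp only [Pi.single_apply, Matrix.one_apply, Fin.ext_iff]
  congr 1
  apply propext; omega

theorem eq_sigma (hn : 1 ≤ n) (Y : Matrix (Fin (n+1)) (Fin (n+1)) F) (hY : deltaPlus Y = 1) :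
    Y = sectSigma (fun i => Y i.castSucc 0) (fun j => Y (Fin.last n) j.rev) := by
  have key : ∀ m : ℕ, ∀ hm : m < n,
      blockA Y ^ m *ᵥ blockU Y = Pi.single (⟨n - 1 - m, by omega⟩ : Fin n) 1 := by
    intro m hm
    ext i
    have h1 := congrFun (congrFun hY i) ⟨n - 1 - m, by omega⟩
    simp only [deltaPlus, Matrix.of_apply] at h1
    rw [show n - 1 - (n - 1 - m) = m by omega] at h1
    rw [h1]
    simp [Matrix.one_apply, Pi.single_apply]
  ext i j
  refine Fin.lastCases ?_ (fun i => ?_) i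
  · simp [sectSigma]
  have hi := i.isLt
  simp only [sectSigma, Matrix.of_apply, Fin.val_castSucc]
  rw [dif_pos hi]
  refine Fin.lastCases ?_ (fun j => ?_) j
  · have h0 := congrFun (key 0 (by omega)) i
    simp only [pow_zero, Matrix.one_mulVec, blockU, Pi.single_apply, Fin.ext_iff] at h0
    rw [Fin.val_last, if_neg (show ¬ n = 0 by omega), zero_add, h0]
    congr 1
    apply propext; omega
  · by_cases hj : (j : ℕ) = 0
    · have : (j.castSucc : Fin (n+1)) = 0 := Fin.ext (by simpa using hj)
      simp [this]
    · have hjn := j.isLt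
      have h0 := key (n - 1 - j + 1) (by omega)
      rw [pow_succ', ← Matrix.mulVec_mulVec, key _ (by omega), Matrix.mulVec_single_one] at h0
      have h1 := congrFun h0 i
      simp only [Matrix.col_apply, blockA, Matrix.of_apply, Pi.single_apply, Fin.ext_iff] at h1
      have h2 : (⟨n - 1 - (n - 1 - (j:ℕ)), by omega⟩ : Fin n) = j := Fin.ext (by simp; omega)
      rw [h2] at h1
      rw [Fin.val_castSucc, if_neg hj, zero_add, h1]
      congr 1
      apply propext; omega

/-- Normalized representative. -/
noncomputable def nrm (X : Matrix (Fin (n+1)) (Fin (n+1)) F) : Matrix (Fin (n+1)) (Fin (n+1)) F :=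
  emb (deltaPlus X)⁻¹ * X * emb (deltaPlus X)

/-- Coordinates `(a,b)` of the normalized representative. -/
noncomputable def coords (X : Matrix (Fin (n+1)) (Fin (n+1)) F) :
    (Fin n → F) × (Fin (n + 1) → F) :=
  (fun i => nrm X i.castSucc 0, fun j => nrm X (Fin.last n) j.rev)

theorem coords_conj (g : Matrix (Fin n) (Fin n) F) (hg : IsUnit g.det) (a : Fin n → F)
    (b : Fin (n + 1) → F) (hn : 1 ≤ n) :
    deltaPlus (emb g * sectSigma a b * emb g⁻¹) = g ∧
    coords (emb g * sectSigma a b * emb g⁻¹) = (a, b) := by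
  have h1 : deltaPlus (emb g * sectSigma a b * emb g⁻¹) = g := by
    rw [deltaPlus_conj _ _ (Matrix.nonsing_inv_mul _ hg), deltaPlus_sigma, Matrix.mul_one]
  refine ⟨h1, ?_⟩
  have h2 : nrm (emb g * sectSigma a b * emb g⁻¹) = sectSigma a b := by
    unfold nrm
    rw [h1]
    simp only [← Matrix.mul_assoc]
    rw [← emb_mul, Matrix.nonsing_inv_mul _ hg, emb_one, Matrix.one_mul, Matrix.mul_assoc,
      ← emb_mul, Matrix.nonsing_inv_mul _ hg, emb_one, Matrix.mul_one]
  unfold coords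
  rw [h2]
  ext i
  · simp [sectSigma]
  · simp [sectSigma]

theorem eq_conj (hn : 1 ≤ n) (X : Matrix (Fin (n+1)) (Fin (n+1)) F)
    (hX : IsUnit (deltaPlus X).det) :
    X = emb (deltaPlus X) * sectSigma (coords X).1 (coords X).2 * emb (deltaPlus X)⁻¹ := by
  have h1 : deltaPlus (nrm X) = 1 := by
    unfold nrm
    rw [deltaPlus_conj _ _ (Matrix.mul_nonsing_inv _ hX), Matrix.nonsing_inv_mul _ hX]
  have h2 := eq_sigma hn _ h1
  have h3 : sectSigma (coords X).1 (coords X).2 = nrm X := h2.symm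
  rw [h3]
  unfold nrm
  simp only [← Matrix.mul_assoc]
  rw [← emb_mul, Matrix.mul_nonsing_inv _ hX, emb_one, Matrix.one_mul, Matrix.mul_assoc,
      ← emb_mul, Matrix.mul_nonsing_inv _ hX, emb_one, Matrix.mul_one]

end Alg

section Top
variable {F : Type*} [NontriviallyNormedField F] {n : ℕ}

theorem continuous_emb : Continuous (emb : Matrix (Fin n) (Fin n) F → _) := by
  refine continuous_matrix fun i j => ?_
  simp only [emb, Matrix.of_apply]
  split_ifs <;> fun_prop

theorem continuous_sigma : Continuous
    (fun p : (Fin n → F) × (Fin (n + 1) → F) => sectSigma p.1 p.2) := by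
  refine continuous_matrix fun i j => ?_
  simp only [sectSigma, Matrix.of_apply]
  split_ifs <;> fun_prop

theorem continuous_deltaPlus :
    Continuous (deltaPlus : Matrix (Fin (n+1)) (Fin (n+1)) F → _) := by
  have hA : Continuous (blockA : Matrix (Fin (n+1)) (Fin (n+1)) F → _) :=
    continuous_matrix fun i j => continuous_id.matrix_elem i.castSucc j.castSucc
  have hU : Continuous (blockU : Matrix (Fin (n+1)) (Fin (n+1)) F → _) := by
    refine continuous_pi fun i => ?_
    exact continuous_id.matrix_elem i.castSucc (Fin.last n)
  refine continuous_matrix fun i j => ?_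
  exact (continuous_apply i).comp ((hA.pow _).matrix_mulVec hU)

theorem continuousOn_inv (K : Set (Matrix (Fin n) (Fin n) F)) (hK : ∀ g ∈ K, IsUnit g.det) :
    ContinuousOn (fun g : Matrix (Fin n) (Fin n) F => g⁻¹) K := by
  have : (fun g : Matrix (Fin n) (Fin n) F => g⁻¹) = fun g => (g.det)⁻¹ • g.adjugate := by
    ext1 g
    rw [Matrix.inv_def, Ring.inverse_eq_inv']
  rw [this]
  have hd : ContinuousOn (fun g : Matrix (Fin n) (Fin n) F => (g.det)⁻¹) K :=
    ContinuousOn.inv₀ (continuous_id.matrix_det).continuousOn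
      (fun g hg => (hK g hg).ne_zero)
  refine ContinuousOn.smul hd ?_
  · exact (continuous_id.matrix_adjugate).continuousOn

theorem continuousOn_coords (K : Set (Matrix (Fin n) (Fin n) F)) (hK : ∀ g ∈ K, IsUnit g.det) :
    ContinuousOn (coords : Matrix (Fin (n+1)) (Fin (n+1)) F → _) (deltaPlus ⁻¹' K) := by
  have hn : ContinuousOn (nrm : Matrix (Fin (n+1)) (Fin (n+1)) F → _) (deltaPlus ⁻¹' K) := by
    unfold nrm
    refine ContinuousOn.mul (ContinuousOn.mul ?_ continuousOn_id) ?_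
    · exact continuous_emb.comp_continuousOn
        ((continuousOn_inv K hK).comp continuous_deltaPlus.continuousOn (fun x hx => hx))
    · exact (continuous_emb.comp continuous_deltaPlus).continuousOn
  refine ContinuousOn.prodMk ?_ ?_
  · refine continuousOn_pi.2 fun i => ?_
    exact (continuous_id.matrix_elem _ _).comp_continuousOn hn
  · refine continuousOn_pi.2 fun i => ?_
    exact (continuous_id.matrix_elem _ _).comp_continuousOn hn

theorem continuousOn_conj (K : Set (Matrix (Fin n) (Fin n) F)) (hK : ∀ g ∈ K, IsUnit g.det)
    (T : Set ((Fin n → F) × (Fin (n + 1) → F))) :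
    ContinuousOn (fun p : Matrix (Fin n) (Fin n) F × ((Fin n → F) × (Fin (n + 1) → F)) =>
      emb p.1 * sectSigma p.2.1 p.2.2 * emb p.1⁻¹) (K ×ˢ T) := by
  refine ContinuousOn.mul (ContinuousOn.mul ?_ ?_) ?_
  · exact (continuous_emb.comp continuous_fst).continuousOn
  · exact (continuous_sigma.comp continuous_snd).continuousOn
  · exact continuous_emb.comp_continuousOn
      ((continuousOn_inv K hK).comp continuous_fst.continuousOn (fun x hx => hx.1))

theorem isOpen_ker (η : Fˣ →* ℂˣ) (hη_cont : Continuous η) (hη_quad : ∀ x, η x * η x = 1) :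
    IsOpen {x : Fˣ | η x = 1} := by
  have : {x : Fˣ | η x = 1} = {x | η x = -1}ᶜ := by
    ext x
    have h1 := hη_quad x
    have h2 : ((η x : ℂˣ) : ℂ) * (η x : ℂˣ) = 1 := by
      rw [← Units.val_mul, h1, Units.val_one]
    have h3 := mul_self_eq_one_iff.1 h2
    simp only [Set.mem_setOf_eq, Set.mem_compl_iff, Units.ext_iff, Units.val_one, Units.val_neg]
    rcases h3 with h | h
    · rw [h]; norm_num
    · rw [h]; norm_num
  rw [this, isOpen_compl_iff]
  exact isClosed_eq hη_cont continuous_const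

theorem exists_K [CompleteSpace F] [IsUltrametricDist F] [LocallyCompactSpace F]
    (η : Fˣ →* ℂˣ) (hη_cont : Continuous η) (hη_quad : ∀ x, η x * η x = 1) :
    ∃ K : Set (Matrix (Fin n) (Fin n) F), IsCompact K ∧ IsClopen K ∧ 1 ∈ K ∧
      (∀ g ∈ K, IsUnit g.det) ∧
      ∀ h : Matrix.GeneralLinearGroup (Fin n) F, (h : Matrix (Fin n) (Fin n) F) ∈ K →
        η (GLdet h) = 1 := by
  let U : Set (Matrix (Fin n) (Fin n) F) := Matrix.det ⁻¹' (Units.val '' {x : Fˣ | η x = 1})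
  have hU : IsOpen U :=
    (Units.isOpenEmbedding_val.isOpenMap _ (isOpen_ker η hη_cont hη_quad)).preimage
      continuous_id.matrix_det
  have h1 : (1 : Matrix (Fin n) (Fin n) F) ∈ U := ⟨1, by simp, by simp⟩
  haveI : LocallyCompactSpace (Matrix (Fin n) (Fin n) F) :=
    inferInstanceAs (LocallyCompactSpace (Fin n → Fin n → F))
  haveI : TotallyDisconnectedSpace (Matrix (Fin n) (Fin n) F) :=
    inferInstanceAs (TotallyDisconnectedSpace (Fin n → Fin n → F))
  obtain ⟨C, hC, h1C, hCU⟩ := exists_compact_subset hU h1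
  obtain ⟨K, hK, h1K, hKC⟩ :=
    (loc_compact_Haus_tot_disc_of_zero_dim (H := Matrix (Fin n) (Fin n) F)).mem_nhds_iff.1
      (isOpen_interior.mem_nhds h1C)
  have hKC' : K ⊆ C := hKC.trans interior_subset
  refine ⟨K, hC.of_isClosed_subset hK.1 hKC', hK, h1K, ?_, ?_⟩
  · intro g hg
    obtain ⟨x, hx, hxg⟩ := hCU (hKC' hg)
    rw [← hxg]; exact x.isUnit
  · intro h hh
    obtain ⟨x, hx, hxg⟩ := hCU (hKC' hh)
    have : GLdet h = x := Units.ext hxg.symm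
    rw [this]; exact hx

theorem isCompact_GL (K : Set (Matrix (Fin n) (Fin n) F)) (hKc : IsCompact K)
    (hK : ∀ g ∈ K, IsUnit g.det) :
    IsCompact {h : Matrix.GeneralLinearGroup (Fin n) F | (h : Matrix (Fin n) (Fin n) F) ∈ K} := by
  rw [Units.isEmbedding_embedProduct.isCompact_iff]
  have : (Units.embedProduct (Matrix (Fin n) (Fin n) F)) ''
      {h : Matrix.GeneralLinearGroup (Fin n) F | (h : Matrix (Fin n) (Fin n) F) ∈ K} =
      (fun g => (g, MulOpposite.op g⁻¹)) '' K := by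
    ext p
    constructor
    · rintro ⟨h, hh, rfl⟩
      refine ⟨h, hh, ?_⟩
      simp [Units.embedProduct]
    · rintro ⟨g, hg, rfl⟩
      refine ⟨Matrix.nonsingInvUnit g (hK g hg), hg, ?_⟩
      simp [Units.embedProduct, Matrix.nonsingInvUnit]
  rw [this]
  exact hKc.image_of_continuousOn (continuousOn_id.prodMk
    (MulOpposite.continuous_op.comp_continuousOn (continuousOn_inv K hK)))

end Top

end ZhangRTF

/-- Conversely, every locally constant compactly supported function of the invariants
arises as the orbital integral along `σ` of some `f` supported in `M_{n+1,+}`. -/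
theorem orbital_integral_surjectivity    (n : ℕ) (hn : 1 ≤ n)
    (F : Type*) [NontriviallyNormedField F] [CompleteSpace F] [CharZero F]
    [IsUltrametricDist F] [LocallyCompactSpace F]
    [MeasurableSpace F] [BorelSpace F]
    (μF : Measure F) [MeasureTheory.Measure.IsAddHaarMeasure μF]
    (hμF : ∀ a : F, a ≠ 0 → ∀ S : Set F,
      μF ((fun x => a * x) '' S) = ENNReal.ofReal ‖a‖ * μF S)
    [MeasurableSpace (Matrix.GeneralLinearGroup (Fin n) F)] [BorelSpace (Matrix.GeneralLinearGroup (Fin n) F)]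
    (μ : Measure (Matrix.GeneralLinearGroup (Fin n) F)) [MeasureTheory.Measure.IsHaarMeasure μ]
    (η : Fˣ →* ℂˣ) (hη_cont : Continuous η) (hη_quad : ∀ x, η x * η x = 1)
    (φ : (Fin n → F) × (Fin (n + 1) → F) → ℂ)
    (hφ_lc : IsLocallyConstant φ) (hφ_supp : HasCompactSupport φ) :
    ∃ f : Matrix (Fin (n + 1)) (Fin (n + 1)) F → ℂ,
      IsLocallyConstant f ∧ HasCompactSupport f ∧
      Function.support f ⊆ {X | DeltaPlus X ≠ 0} ∧
      ∀ (a : Fin n → F) (b : Fin (n + 1) → F),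
        Integrable (fun h : Matrix.GeneralLinearGroup (Fin n) F =>
          f (act h (sectSigma a b)) * ((η (GLdet h) : ℂˣ) : ℂ)) μ ∧
        ∫ h : Matrix.GeneralLinearGroup (Fin n) F, f (act h (sectSigma a b)) * ((η (GLdet h) : ℂˣ) : ℂ) ∂μ = φ (a, b) := by
  classical
  obtain ⟨K, hKc, hKo, h1K, hKu, hKη⟩ := exists_K (n := n) η hη_cont hη_quad
  set S : Set (Matrix.GeneralLinearGroup (Fin n) F) :=
    {h | (h : Matrix (Fin n) (Fin n) F) ∈ K} with hS
  have hSc : IsCompact S := isCompact_GL K hKc hKu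
  have hSo : IsOpen S := hKo.2.preimage Units.continuous_val
  have hSne : S.Nonempty := ⟨1, by simpa [hS] using h1K⟩
  have hpos : μ S ≠ 0 := (hSo.measure_pos μ hSne).ne'
  have hfin : μ S ≠ ⊤ := hSc.measure_lt_top.ne
  have hc : ((μ.real S : ℝ) : ℂ) ≠ 0 := by
    exact_mod_cast (ENNReal.toReal_pos hpos hfin).ne'
  have hPcl : IsClopen (deltaPlus ⁻¹' K : Set (Matrix (Fin (n + 1)) (Fin (n + 1)) F)) :=
    hKo.preimage continuous_deltaPlus
  let f : Matrix (Fin (n + 1)) (Fin (n + 1)) F → ℂ := fun X =>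
    if deltaPlus X ∈ K then φ (coords X) / (μ.real S : ℝ) else 0
  refine ⟨f, ?_, ?_, ?_, ?_⟩
  · rw [IsLocallyConstant.iff_eventually_eq]
    intro X
    by_cases hX : deltaPlus X ∈ K
    · have hnh : (deltaPlus ⁻¹' K : Set (Matrix (Fin (n + 1)) (Fin (n + 1)) F)) ∈ nhds X :=
        hPcl.2.mem_nhds hX
      have hca : ContinuousAt coords X := (continuousOn_coords K hKu).continuousAt hnh
      have hev := hca.eventually ((IsLocallyConstant.iff_eventually_eq φ).1 hφ_lc (coords X))
      filter_upwards [hnh, hev] with Y hY hY2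
      have hY' : deltaPlus Y ∈ K := hY
      simp only [f, if_pos hX, if_pos hY', hY2]
    · filter_upwards [hPcl.compl.2.mem_nhds hX] with Y hY
      have hY' : deltaPlus Y ∉ K := hY
      simp only [f, if_neg hX, if_neg hY']
  · refine HasCompactSupport.intro
      ((hKc.prod hφ_supp.isCompact).image_of_continuousOn (continuousOn_conj K hKu (tsupport φ))) ?_
    intro X hX
    by_contra hne
    apply hX
    by_cases hXK : deltaPlus X ∈ K
    · refine ⟨(deltaPlus X, coords X), ⟨hXK, subset_tsupport _ ?_⟩, (eq_conj hn X (hKu _ hXK)).symm⟩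
      intro h0
      apply hne
      change φ (coords X) = 0 at h0
      simp [f, h0]
    · exact absurd (by simp [f, hXK]) hne
  · intro X hX
    by_cases hXK : deltaPlus X ∈ K
    · exact (hKu _ hXK).ne_zero
    · exact absurd (by simp [f, hXK]) hX
  · intro a b
    have hfun : (fun h : Matrix.GeneralLinearGroup (Fin n) F =>
          f (act h (sectSigma a b)) * ((η (GLdet h) : ℂˣ) : ℂ)) =
        S.indicator (fun _ => φ (a, b) / ((μ.real S : ℝ) : ℂ)) := by
      ext h
      have hu : IsUnit (h : Matrix (Fin n) (Fin n) F).det :=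
        (Matrix.isUnit_iff_isUnit_det _).1 h.isUnit
      obtain ⟨h1, h2⟩ := coords_conj (h : Matrix (Fin n) (Fin n) F) hu a b hn
      have hact : act h (sectSigma a b) = emb (h : Matrix (Fin n) (Fin n) F) * sectSigma a b *
          emb (h : Matrix (Fin n) (Fin n) F)⁻¹ := by
        unfold act
        rw [Matrix.coe_units_inv]
      rw [hact]
      simp only [f, h1, h2]
      by_cases hh : h ∈ S
      · have hh' : (h : Matrix (Fin n) (Fin n) F) ∈ K := hh
        rw [if_pos hh', Set.indicator_of_mem hh, hKη h hh]
        simp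
      · have hh' : (h : Matrix (Fin n) (Fin n) F) ∉ K := hh
        rw [if_neg hh', Set.indicator_of_notMem hh]
        simp
    rw [hfun]
    refine ⟨?_, ?_⟩
    · exact (integrable_indicator_iff hSo.measurableSet).2 (integrableOn_const hfin)
    · rw [integral_indicator_const _ hSo.measurableSet, Complex.real_smul]
      field_simp
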